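/- arXiv:1505.01957 — 2 statements merged into one kernel-verified Lean document; each statement's English description precedes it below -/
import Mathlib

section
/- Let m ≥ 1 and let Σ = (σ_ij) be an m×m positive semi-definite real matrix with σ_jj > 0 for all 1 ≤ j ≤ m. Let X = (X_1,…,X_m) ~ N(0, Σ) and let w = (w_1,…,w_m) be a random vector independent of X with w_j ≥ 0 for all j and w_1 + ⋯ + w_m = 1 almost surely. Then the quadratic form (w_1/X_1, …, w_m/X_m) Σ (w_1/X_1, …, w_m/X_m)ᵀ = Σ_{i=1}^m Σ_{j=1}^m w_i w_j σ_ij / (X_i X_j) is distributed as χ⁻²_1, the inverse chi-squared distribution with one degree of freedom (i.e., the standard Lévy distribution with location 0 and scale 1). -/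
open MeasureTheory ProbabilityTheory Real

/-- A measure `μ` on `ℝᵐ` is the centered multivariate normal distribution `N(0, S)`
iff it is a probability measure and every linear functional `x ↦ ∑ i, t i * x i`
pushes it forward to a centered real Gaussian with variance `t Σ tᵀ` (Cramér–Wold). -/
def IsMvGaussian {m : ℕ} (S : Matrix (Fin m) (Fin m) ℝ) (μ : Measure (Fin m → ℝ)) : Prop :=
  IsProbabilityMeasure μ ∧
    ∀ t : Fin m → ℝ,
      μ.map (fun x => ∑ i, t i * x i) =
        gaussianReal 0 (Real.toNNReal (∑ i, ∑ j, t i * S i j * t j))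

/-- The inverse chi-squared distribution with one degree of freedom `χ⁻²₁`
(the standard Lévy distribution `Lévy(0,1)`): the distribution of `1 / Z²`
for `Z` a standard normal random variable. -/
noncomputable def stdLevy : Measure ℝ :=
  (gaussianReal 0 1).map fun z => (z ^ 2)⁻¹


noncomputable def TT (ζ q : ℂ) : ℂ :=
  Complex.I * (((starRingEnd ℂ) ζ - ζ * q) / ((starRingEnd ℂ) ζ + ζ * q))

lemma TT_im_nonneg (ζ q : ℂ) (hq : ‖q‖ ≤ 1) : 0 ≤ (TT ζ q).im := by
  have key : ∀ a b : ℂ, ‖b‖ ≤ ‖a‖ → 0 ≤ ((a - b) / (a + b)).re := by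
    intro a b h
    have h2 : b.re * b.re + b.im * b.im ≤ a.re * a.re + a.im * a.im := by
      have : ‖b‖ ^ 2 ≤ ‖a‖ ^ 2 := by gcongr
      rw [← Complex.normSq_eq_norm_sq, ← Complex.normSq_eq_norm_sq] at this
      simpa [Complex.normSq_apply] using this
    rw [Complex.div_re, ← add_div]
    apply div_nonneg _ (Complex.normSq_nonneg _)
    simp only [Complex.sub_re, Complex.add_re, Complex.sub_im, Complex.add_im]
    nlinarith
  have := key ((starRingEnd ℂ) ζ) (ζ * q) (by
    rw [norm_mul, RCLike.norm_conj]
    exact mul_le_of_le_one_right (norm_nonneg _) hq)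
  simpa [TT] using this

lemma TT_zero (ζ : ℂ) (h : ζ ≠ 0) : TT ζ 0 = Complex.I := by
  have : (starRingEnd ℂ) ζ ≠ 0 := by simpa using h
  simp [TT, this]

lemma TT_circle (x y θ : ℝ) :
    TT ⟨x, y⟩ (circleMap 0 1 θ) =
      (((sin (θ/2) * x + cos (θ/2) * y) / (cos (θ/2) * x - sin (θ/2) * y) : ℝ) : ℂ) := by
  have hq : circleMap 0 1 θ = Complex.exp ((θ/2 : ℝ) * Complex.I) * Complex.exp ((θ/2 : ℝ) * Complex.I) := by
    rw [← Complex.exp_add]; simp [circleMap]; congr 1; ring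
  set e := Complex.exp ((θ/2 : ℝ) * Complex.I) with he
  have hecs : e = ⟨cos (θ/2), sin (θ/2)⟩ := by
    rw [he]
    apply Complex.ext
    · rw [Complex.exp_ofReal_mul_I_re]
    · rw [Complex.exp_ofReal_mul_I_im]
  have hee : e * (starRingEnd ℂ) e = 1 := by
    rw [hecs]
    apply Complex.ext <;> simp
    · nlinarith [sin_sq_add_cos_sq (θ/2)]
    · ring
  have he0 : e ≠ 0 := Complex.exp_ne_zero _
  set z : ℂ := ⟨x, y⟩
  unfold TT
  rw [hq]
  have h1 : (starRingEnd ℂ) z = e * (starRingEnd ℂ) (z * e) := by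
    rw [map_mul]; linear_combination (-(starRingEnd ℂ) z) * hee
  have h2 : z * (e * e) = e * (z * e) := by ring
  rw [h2, h1, ← mul_sub, ← mul_add, mul_div_mul_left _ _ he0]
  have h3 : (starRingEnd ℂ) (z * e) - z * e = -(2 * Complex.I * ((z * e).im : ℂ)) := by
    apply Complex.ext <;> simp
    ring
  have h4 : (starRingEnd ℂ) (z * e) + z * e = 2 * ((z * e).re : ℂ) := by
    apply Complex.ext
    · simp; ring
    · simp; ring
  rw [h3, h4]
  have h5 : (z * e).im = sin (θ/2) * x + cos (θ/2) * y := by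
    simp [hecs, z]; ring
  have h6 : (z * e).re = cos (θ/2) * x - sin (θ/2) * y := by
    simp [hecs, z]; ring
  rw [h5, h6, Complex.ofReal_div, ← mul_div_assoc]
  have : Complex.I * -(2 * Complex.I * ((sin (θ/2) * x + cos (θ/2) * y : ℝ) : ℂ))
      = 2 * ((sin (θ/2) * x + cos (θ/2) * y : ℝ) : ℂ) := by
    linear_combination (-2 * ((sin (θ/2) * x + cos (θ/2) * y : ℝ) : ℂ)) * Complex.I_mul_I
  rw [this, mul_div_mul_left _ _ two_ne_zero]

lemma TT_differentiableAt (ζ q : ℂ) (h : (starRingEnd ℂ) ζ + ζ * q ≠ 0) :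
    DifferentiableAt ℂ (TT ζ) q := by
  unfold TT
  fun_prop (disch := exact h)

lemma TT_denom (ζ q : ℂ) (hζ : ζ ≠ 0) (hq : ‖q‖ < 1) : (starRingEnd ℂ) ζ + ζ * q ≠ 0 := by
  intro h
  have : ‖(starRingEnd ℂ) ζ‖ = ‖ζ * q‖ := by
    rw [eq_neg_of_add_eq_zero_left h, norm_neg]
  rw [norm_mul, RCLike.norm_conj] at this
  have h0 : 0 < ‖ζ‖ := norm_pos_iff.mpr hζ
  nlinarith

lemma mean_value {m : ℕ} (ζ : Fin m → ℂ) (hζ : ∀ j, ζ j ≠ 0) (w : Fin m → ℝ)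
    (hw0 : ∀ j, 0 ≤ w j) (hw1 : ∑ j, w j = 1) (t : ℝ) (ht : 0 ≤ t) :
    ∫ θ in (0:ℝ)..2 * π,
      Complex.exp (Complex.I * t * ∑ j, (w j : ℂ) * TT (ζ j) (circleMap 0 1 θ))
      = 2 * π * Complex.exp (-t) := by
  set f : ℂ → ℂ := fun q => Complex.exp (Complex.I * t * ∑ j, (w j : ℂ) * TT (ζ j) q) with hf
  have hdiff : ∀ q : ℂ, (∀ j, (starRingEnd ℂ) (ζ j) + ζ j * q ≠ 0) → DifferentiableAt ℂ f q := by
    intro q hq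
    have : ∀ j, DifferentiableAt ℂ (TT (ζ j)) q := fun j => TT_differentiableAt _ _ (hq j)
    simp only [hf]
    fun_prop
  have hbound : ∀ q : ℂ, ‖q‖ ≤ 1 → ‖f q‖ ≤ 1 := by
    intro q hq
    simp only [hf]
    rw [Complex.norm_exp, Real.exp_le_one_iff]
    have h1 : (Complex.I * t * ∑ j, (w j : ℂ) * TT (ζ j) q).re
        = - (t * ∑ j, w j * (TT (ζ j) q).im) := by
      rw [mul_assoc, Complex.I_mul_re]
      simp [Complex.im_sum]
    rw [h1]
    have : 0 ≤ t * ∑ j, w j * (TT (ζ j) q).im :=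
      mul_nonneg ht (Finset.sum_nonneg fun j _ => mul_nonneg (hw0 j) (TT_im_nonneg _ _ hq))
    linarith
  have hf0 : f 0 = Complex.exp (-t) := by
    simp only [hf]
    congr 1
    simp_rw [TT_zero _ (hζ _)]
    rw [← Finset.sum_mul, ← Complex.ofReal_sum, hw1]
    push_cast
    linear_combination (t : ℂ) * Complex.I_mul_I
  have hr : ∀ r : ℝ, r ∈ Set.Ioo (0:ℝ) 1 →
      ∫ θ in (0:ℝ)..2 * π, f (circleMap 0 r θ) = 2 * π * Complex.exp (-t) := by
    intro r hr
    have h := DiffContOnCl.circleAverage (f := f) (c := 0) (R := r) (by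
      rw [abs_of_pos hr.1]
      apply DifferentiableOn.diffContOnCl
      intro q hq
      rw [closure_ball _ hr.1.ne'] at hq
      refine (hdiff q fun j => TT_denom _ _ (hζ j) ?_).differentiableWithinAt
      have : ‖q‖ ≤ r := by simpa using hq
      linarith [hr.2])
    rw [Real.circleAverage_def, hf0] at h
    rw [← h, Complex.real_smul]
    push_cast
    rw [← mul_assoc, mul_inv_cancel₀ (by simp [Real.pi_ne_zero]), one_mul]
  have hlim : Filter.Tendsto (fun r : ℝ => ∫ θ in (0:ℝ)..2 * π, f (circleMap 0 r θ))
      (nhdsWithin 1 (Set.Iio 1)) (nhds (∫ θ in (0:ℝ)..2 * π, f (circleMap 0 1 θ))) := by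
    have hev : ∀ᶠ r : ℝ in nhdsWithin 1 (Set.Iio 1), r ∈ Set.Ioo (0:ℝ) 1 :=
      Ioo_mem_nhdsLT zero_lt_one
    have hmeas : ∀ r : ℝ, Measurable fun θ => f (circleMap 0 r θ) := by
      intro r
      have : Measurable (circleMap 0 r) := (continuous_circleMap 0 r).measurable
      simp only [hf, TT]
      fun_prop
    apply intervalIntegral.tendsto_integral_filter_of_dominated_convergence (fun _ => 1)
    · exact Filter.Eventually.of_forall fun r => (hmeas r).aestronglyMeasurable
    · filter_upwards [hev] with r hr
      refine Filter.Eventually.of_forall fun θ _ => hbound _ ?_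
      simp [abs_of_pos hr.1, hr.2.le]
    · exact intervalIntegrable_const
    · have hc : (circleMap 0 1 ⁻¹' (Set.range fun j => -(starRingEnd ℂ) (ζ j) / ζ j)).Countable :=
        (Set.countable_range _).preimage_circleMap 0 one_ne_zero
      filter_upwards [hc.ae_notMem volume] with θ hθ _
      have hd : ContinuousAt f (circleMap 0 1 θ) := by
        refine (hdiff _ fun j h => hθ ⟨j, ?_⟩).continuousAt
        simp only
        rw [div_eq_iff (hζ j)]
        linear_combination -h
      have hcm : Filter.Tendsto (fun r : ℝ => circleMap 0 r θ) (nhdsWithin 1 (Set.Iio 1))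
          (nhds (circleMap 0 1 θ)) := by
        have : Continuous fun r : ℝ => circleMap 0 r θ := by
          unfold circleMap; fun_prop
        exact this.continuousAt.mono_left nhdsWithin_le_nhds
      exact hd.tendsto.comp hcm
  refine tendsto_nhds_unique hlim ?_
  apply tendsto_const_nhds.congr'
  filter_upwards [Ioo_mem_nhdsLT (zero_lt_one (α := ℝ))] with r h
  exact (hr r h).symm

lemma laplace_unique (μ ν : Measure ℝ) [IsProbabilityMeasure μ] [IsProbabilityMeasure ν]
    (hμ : ∀ᵐ x ∂μ, 0 ≤ x) (hν : ∀ᵐ x ∂ν, 0 ≤ x)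
    (h : ∀ n : ℕ, ∫ x, Real.exp (-(n * x)) ∂μ = ∫ x, Real.exp (-(n * x)) ∂ν) : μ = ν := by
  have key : ∀ (ρ : Measure ℝ) [IsProbabilityMeasure ρ], (∀ᵐ x ∂ρ, 0 ≤ x) → ∀ t : ℝ,
      HasSum (fun n : ℕ => (t * Complex.I) ^ n / (n.factorial : ℂ) *
        ((∫ x, Real.exp (-(n * x)) ∂ρ : ℝ) : ℂ))
        (charFun (ρ.map fun x => Real.exp (-x)) t) := by
    intro ρ _ hρ t
    rw [charFun_apply_real, integral_map (by fun_prop) (by fun_prop)]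
    have := hasSum_integral_of_dominated_convergence (μ := ρ)
      (F := fun (n : ℕ) x => (t * Complex.I) ^ n / (n.factorial : ℂ) * ((Real.exp (-(n * x)) : ℝ) : ℂ))
      (f := fun x => Complex.exp (t * (Real.exp (-x) : ℝ) * Complex.I))
      (fun n _ => |t| ^ n / n.factorial) ?_ ?_ ?_ ?_ ?_
    · have e : (fun n : ℕ => (t * Complex.I) ^ n / (n.factorial : ℂ) *
          ((∫ x, Real.exp (-(n * x)) ∂ρ : ℝ) : ℂ)) = fun n : ℕ => ∫ x, (t * Complex.I) ^ n /
          (n.factorial : ℂ) * ((Real.exp (-(n * x)) : ℝ) : ℂ) ∂ρ := by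
        ext n
        rw [integral_const_mul, integral_complex_ofReal]
      rw [e]
      exact this
    · intro n; fun_prop
    · intro n
      filter_upwards [hρ] with x hx
      rw [norm_mul, norm_div, norm_pow, norm_mul, Complex.norm_I, mul_one]
      simp only [Complex.norm_real, Real.norm_eq_abs, Complex.norm_natCast, Real.abs_exp]
      apply mul_le_of_le_one_right (by positivity)
      rw [Real.exp_le_one_iff]
      have : 0 ≤ n * x := by positivity
      linarith
    · exact Filter.Eventually.of_forall fun _ => Real.summable_pow_div_factorial _
    · exact integrable_const _
    · refine Filter.Eventually.of_forall fun x => ?_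
      have := NormedSpace.expSeries_div_hasSum_exp (𝔸 := ℂ) (t * (Real.exp (-x) : ℝ) * Complex.I)
      rw [← Complex.exp_eq_exp_ℂ] at this
      have e : (fun n : ℕ => (t * Complex.I) ^ n / (n.factorial : ℂ) *
          ((Real.exp (-(n * x)) : ℝ) : ℂ)) = fun n : ℕ =>
          (t * (Real.exp (-x) : ℝ) * Complex.I) ^ n / (n.factorial : ℂ) := by
        ext n
        have : Real.exp (-(n * x)) = Real.exp (-x) ^ n := by
          rw [← Real.exp_nat_mul]; congr 1; ring
        rw [this, Complex.ofReal_pow]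
        ring
      simp only [e]
      exact this
  have h1 : μ.map (fun x => Real.exp (-x)) = ν.map (fun x => Real.exp (-x)) := by
    have := Measure.isProbabilityMeasure_map (μ := μ) (f := fun x => Real.exp (-x)) (by fun_prop)
    have := Measure.isProbabilityMeasure_map (μ := ν) (f := fun x => Real.exp (-x)) (by fun_prop)
    apply Measure.ext_of_charFun
    ext t
    refine (key μ hμ t).unique ?_
    simp_rw [h]
    exact key ν hν t
  have h2 : ∀ ρ : Measure ℝ, (ρ.map (fun x => Real.exp (-x))).map (fun y => -Real.log y) = ρ := by
    intro ρ
    rw [Measure.map_map (by fun_prop) (by fun_prop)]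
    convert Measure.map_id
    ext x; simp
  rw [← h2 μ, h1, h2]

lemma isGaussian_of {m : ℕ} {S : Matrix (Fin m) (Fin m) ℝ} {μ : Measure (Fin m → ℝ)}
    (h : IsMvGaussian S μ) : IsGaussian μ ∧ ∀ L : StrongDual ℝ (Fin m → ℝ), μ[L] = 0 := by
  have hp := h.1
  have hL : ∀ L : StrongDual ℝ (Fin m → ℝ), ∃ v, μ.map L = gaussianReal 0 v := by
    intro L
    refine ⟨(∑ i, ∑ j, L (Pi.single i 1) * S i j * L (Pi.single j 1)).toNNReal, ?_⟩
    · rw [← h.2 fun i => L (Pi.single i 1)]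
      congr 1
      ext x
      conv_lhs => rw [← Finset.univ_sum_single x, map_sum]
      refine Finset.sum_congr rfl fun i _ => ?_
      have : Pi.single i (x i) = x i • (Pi.single i 1 : Fin m → ℝ) := by
        rw [← Pi.single_smul]; simp
      rw [this, map_smul, smul_eq_mul, mul_comm]
  have hmean : ∀ L : StrongDual ℝ (Fin m → ℝ), μ[L] = 0 := by
    intro L
    obtain ⟨v, hv⟩ := hL L
    have : ∫ x, x ∂(μ.map L) = μ[L] := integral_map (by fun_prop) (by fun_prop)
    rw [← this, hv, integral_id_gaussianReal]
  refine ⟨⟨fun L => ?_⟩, hmean⟩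
  obtain ⟨v, hv⟩ := hL L
  have : Var[id; μ.map L] = Var[L; μ] := by
    rw [variance_map (by fun_prop) (by fun_prop)]; rfl
  rw [hmean, ← this, hv, variance_id_gaussianReal]
  simp

lemma ae_ne_zero {m : ℕ} {S : Matrix (Fin m) (Fin m) ℝ} {μ : Measure (Fin m → ℝ)}
    (hdiag : ∀ j, 0 < S j j) (h : IsMvGaussian S μ) : ∀ᵐ x ∂μ, ∀ j, x j ≠ 0 := by
  rw [ae_all_iff]
  intro j
  have h1 := h.2 (Pi.single j 1)
  have h2 : (fun x : Fin m → ℝ => ∑ i, (Pi.single j 1 : Fin m → ℝ) i * x i) = fun x => x j := by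
    ext x; simp [Pi.single_apply]
  have h3 : (∑ i, ∑ k, (Pi.single j 1 : Fin m → ℝ) i * S i k * (Pi.single j 1 : Fin m → ℝ) k)
      = S j j := by
    simp [Pi.single_apply]
  rw [h2, h3] at h1
  have hv : (S j j).toNNReal ≠ 0 := by simpa using hdiag j
  have := nullSingletonClass_gaussianReal (μ := 0) hv
  have h4 : ∀ᵐ y ∂(μ.map fun x => x j), y ≠ 0 := by
    rw [h1]
    exact Measure.ae_ne _ 0
  exact ae_of_ae_map (f := fun x : Fin m → ℝ => x j) (p := fun y => y ≠ 0) (measurable_pi_apply j).aemeasurable h4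

noncomputable def GG {m : ℕ} (w : Fin m → ℝ) (t : ℝ) (p : (Fin m → ℝ) × (Fin m → ℝ)) : ℂ :=
  Complex.exp (Complex.I * t * ∑ j, (w j : ℂ) * ((p.2 j / p.1 j : ℝ) : ℂ))

lemma GG_norm {m : ℕ} (w : Fin m → ℝ) (t : ℝ) (p : (Fin m → ℝ) × (Fin m → ℝ)) :
    ‖GG w t p‖ = 1 := by
  unfold GG
  have : Complex.I * t * ∑ j, (w j : ℂ) * ((p.2 j / p.1 j : ℝ) : ℂ)
    = ((t * ∑ j, w j * (p.2 j / p.1 j) : ℝ) : ℂ) * Complex.I := by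
    push_cast; ring
  rw [this, Complex.norm_exp_ofReal_mul_I]

lemma GG_meas {m : ℕ} (w : Fin m → ℝ) (t : ℝ) : Measurable (GG w t) := by
  unfold GG
  fun_prop

lemma laplace_fixed {m : ℕ} {S : Matrix (Fin m) (Fin m) ℝ} {μ : Measure (Fin m → ℝ)}
    (hS : S.PosSemidef) (hdiag : ∀ j, 0 < S j j) (h : IsMvGaussian S μ) (w : Fin m → ℝ)
    (hw0 : ∀ j, 0 ≤ w j) (hw1 : ∑ j, w j = 1) (t : ℝ) (ht : 0 ≤ t) :
    ∫ x, Real.exp (-(t ^ 2 / 2 * ∑ i, ∑ j, w i * w j * S i j / (x i * x j))) ∂μ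
      = Real.exp (-t) := by
  have hp := h.1
  obtain ⟨hG, hmean⟩ := isGaussian_of h
  have hGint : Integrable (GG w t) (μ.prod μ) := by
    refine Integrable.of_bound (GG_meas w t).aestronglyMeasurable 1 ?_
    exact Filter.Eventually.of_forall fun p => (GG_norm w t p).le
  have step1 : ∫ p, GG w t p ∂(μ.prod μ) =
      ((∫ x, Real.exp (-(t ^ 2 / 2 * ∑ i, ∑ j, w i * w j * S i j / (x i * x j))) ∂μ : ℝ) : ℂ) := by
    rw [integral_prod _ hGint, ← integral_complex_ofReal]
    congr 1
    ext x
    have h1 := congrArg (fun ρ => charFun ρ t) (h.2 fun i => w i / x i)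
    simp only [charFun_gaussianReal] at h1
    rw [charFun_apply_real, integral_map (Measurable.aemeasurable (by fun_prop)) (by fun_prop)] at h1
    have hQ : ∑ i, ∑ j, w i / x i * S i j * (w j / x j)
        = ∑ i, ∑ j, w i * w j * S i j / (x i * x j) := by
      refine Finset.sum_congr rfl fun i _ => Finset.sum_congr rfl fun j _ => ?_
      rw [div_mul_eq_mul_div, div_mul_div_comm]; ring
    have hQ0 : 0 ≤ ∑ i, ∑ j, w i * w j * S i j / (x i * x j) := by
      rw [← hQ]
      have := hS.dotProduct_mulVec_nonneg (fun i => w i / x i)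
      simpa [dotProduct, Matrix.mulVec, Finset.mul_sum, mul_assoc] using this
    rw [hQ, Real.coe_toNNReal _ hQ0] at h1
    have h2 : ∫ y, GG w t (x, y) ∂μ =
        ∫ y, Complex.exp (t * ((∑ i, w i / x i * y i : ℝ) : ℂ) * Complex.I) ∂μ := by
      congr 1
      ext y
      unfold GG
      congr 1
      push_cast
      rw [mul_comm Complex.I, mul_assoc, mul_assoc, mul_comm Complex.I]
      congr 2
      refine Finset.sum_congr rfl fun i _ => ?_
      ring
    rw [h2, h1]
    push_cast
    congr 1
    ring
  have step2 : ∀ θ : ℝ, ∫ p, GG w t (ContinuousLinearMap.rotation (-(θ/2)) p) ∂(μ.prod μ)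
      = ∫ p, GG w t p ∂(μ.prod μ) := by
    intro θ
    have := IsGaussian.map_rotation_eq_self_of_forall_strongDual_eq_zero hmean (-(θ/2))
    conv_rhs => rw [← this]
    rw [integral_map (by fun_prop) (GG_meas w t).aestronglyMeasurable]
  have hrot : Measurable fun q : ℝ × ((Fin m → ℝ) × (Fin m → ℝ)) =>
      GG w t (ContinuousLinearMap.rotation (-(q.1/2)) q.2) := by
    refine (GG_meas w t).comp ?_
    simp only [ContinuousLinearMap.rotation_apply]
    fun_prop
  have step3 : ∫ θ in (0:ℝ)..2*π, ∫ p, GG w t (ContinuousLinearMap.rotation (-(θ/2)) p) ∂(μ.prod μ)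
      = ∫ p, (∫ θ in (0:ℝ)..2*π, GG w t (ContinuousLinearMap.rotation (-(θ/2)) p)) ∂(μ.prod μ) := by
    simp_rw [intervalIntegral.integral_of_le two_pi_pos.le]
    refine integral_integral_swap ?_
    refine Integrable.of_bound hrot.aestronglyMeasurable 1 ?_
    exact Filter.Eventually.of_forall fun p => (GG_norm w t _).le
  have step4 : ∀ᵐ p ∂(μ.prod μ), ∫ θ in (0:ℝ)..2*π,
      GG w t (ContinuousLinearMap.rotation (-(θ/2)) p) = 2 * π * Complex.exp (-t) := by
    have hne : ∀ᵐ p ∂(μ.prod μ), ∀ j, p.1 j ≠ 0 :=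
      Measure.quasiMeasurePreserving_fst.ae (ae_ne_zero hdiag h)
    filter_upwards [hne] with p hp
    rw [← mean_value (fun j => ⟨p.1 j, p.2 j⟩) (fun j hj => hp j (congrArg Complex.re hj))
      w hw0 hw1 t ht]
    congr 1
    ext θ
    simp_rw [TT_circle]
    simp [GG, ContinuousLinearMap.rotation_apply, sub_eq_add_neg]
  simp_rw [step2] at step3
  rw [integral_congr_ae step4, step1] at step3
  simp only [intervalIntegral.integral_const, integral_const, sub_zero, probReal_univ, one_smul,
    Complex.real_smul] at step3
  push_cast at step3
  have h5 : (2 * π : ℂ) ≠ 0 := by simp [Real.pi_ne_zero]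
  have := mul_left_cancel₀ h5 step3
  exact_mod_cast this

lemma Q_nonneg {m : ℕ} {S : Matrix (Fin m) (Fin m) ℝ} (hS : S.PosSemidef) (w x : Fin m → ℝ) :
    0 ≤ ∑ i, ∑ j, w i * w j * S i j / (x i * x j) := by
  have := hS.dotProduct_mulVec_nonneg (fun i => w i / x i)
  simp only [dotProduct, Matrix.mulVec, Finset.mul_sum, Pi.star_apply, star_trivial] at this
  refine this.trans_eq (Finset.sum_congr rfl fun i _ => Finset.sum_congr rfl fun j _ => ?_)
  rw [← mul_assoc, div_mul_eq_mul_div, div_mul_div_comm]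
  ring

lemma laplace_random {m : ℕ} {S : Matrix (Fin m) (Fin m) ℝ}
    (hS : S.PosSemidef) (hdiag : ∀ j, 0 < S j j)
    {Ω : Type*} [MeasurableSpace Ω] (P : Measure Ω) [IsProbabilityMeasure P]
    (X : Ω → Fin m → ℝ) (hX : Measurable X) (hXlaw : IsMvGaussian S (P.map X))
    (w : Ω → Fin m → ℝ) (hw : Measurable w) (hwX : IndepFun w X P)
    (hw0 : ∀ᵐ ω ∂P, ∀ j, 0 ≤ w ω j) (hw1 : ∀ᵐ ω ∂P, ∑ j, w ω j = 1) (s : ℝ) (hs : 0 ≤ s) :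
    ∫ z, Real.exp (-(s * z))
      ∂(P.map (fun ω => ∑ i, ∑ j, w ω i * w ω j * S i j / (X ω i * X ω j)))
      = Real.exp (-√(2 * s)) := by
  have hp := hXlaw.1
  have hpw : IsProbabilityMeasure (P.map w) := Measure.isProbabilityMeasure_map hw.aemeasurable
  rw [integral_map (by fun_prop) (by fun_prop)]
  have hlaw := (indepFun_iff_map_prod_eq_prod_map_map hw.aemeasurable hX.aemeasurable).1 hwX
  set F : (Fin m → ℝ) × (Fin m → ℝ) → ℝ := fun p =>
    Real.exp (-(s * ∑ i, ∑ j, p.1 i * p.1 j * S i j / (p.2 i * p.2 j))) with hF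
  have hFm : Measurable F := by fun_prop
  have e1 : ∫ ω, Real.exp (-(s * ∑ i, ∑ j, w ω i * w ω j * S i j / (X ω i * X ω j))) ∂P
      = ∫ p, F p ∂((P.map w).prod (P.map X)) := by
    rw [← hlaw, integral_map (by fun_prop) hFm.aestronglyMeasurable]
  rw [e1, integral_prod]
  · have : ∀ᵐ v ∂(P.map w), ∫ x, F (v, x) ∂(P.map X) = Real.exp (-√(2 * s)) := by
      have hm : MeasurableSet {v : Fin m → ℝ | (∀ j, 0 ≤ v j) ∧ ∑ j, v j = 1} := by
        measurability
      have : ∀ᵐ v ∂(P.map w), (∀ j, 0 ≤ v j) ∧ ∑ j, v j = 1 := by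
        rw [ae_map_iff hw.aemeasurable hm]
        filter_upwards [hw0, hw1] with ω h0 h1 using ⟨h0, h1⟩
      filter_upwards [this] with v hv
      rw [← laplace_fixed hS hdiag hXlaw v hv.1 hv.2 (√(2 * s)) (Real.sqrt_nonneg _),
        Real.sq_sqrt (by positivity)]
      simp [hF]
    rw [integral_congr_ae this]
    simp
  · refine Integrable.of_bound hFm.aestronglyMeasurable 1 ?_
    refine Filter.Eventually.of_forall fun p => ?_
    simp only [hF, Real.norm_eq_abs, Real.abs_exp, Real.exp_le_one_iff]
    have := mul_nonneg hs (Q_nonneg hS p.1 p.2)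
    linarith

lemma laplace_levy (s : ℝ) (hs : 0 ≤ s) :
    ∫ z, Real.exp (-(s * z)) ∂stdLevy = Real.exp (-√(2 * s)) := by
  have := laplace_random (m := 1) (S := 1) Matrix.PosSemidef.one (by simp) (gaussianReal 0 1)
    (fun z _ => z) (by fun_prop) (by
      refine ⟨Measure.isProbabilityMeasure_map (by fun_prop), fun t => ?_⟩
      rw [Measure.map_map (by fun_prop) (by fun_prop)]
      have : ((fun x : Fin 1 → ℝ => ∑ i, t i * x i) ∘ fun (z : ℝ) _ => z) = fun z => t 0 * z := by
        ext z; simp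
      rw [this, gaussianReal_map_const_mul]
      simp only [mul_zero, mul_one]
      congr 1
      ext
      simp [Real.coe_toNNReal _ (mul_self_nonneg (t 0)), sq])
    (fun _ _ => 1) (by fun_prop) (indepFun_const_left _ _) (by simp) (by simp) s hs
  rw [← this, stdLevy]
  congr 2
  ext z
  simp [sq]

theorem statement3 {m : ℕ} (hm : 1 ≤ m) (S : Matrix (Fin m) (Fin m) ℝ)
    (hS : S.PosSemidef) (hdiag : ∀ j, 0 < S j j)
    {Ω : Type*} [MeasurableSpace Ω] (P : Measure Ω) [IsProbabilityMeasure P]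
    (X : Ω → Fin m → ℝ) (hX : Measurable X) (hXlaw : IsMvGaussian S (P.map X))
    (w : Ω → Fin m → ℝ) (hw : Measurable w) (hwX : IndepFun w X P)
    (hw0 : ∀ᵐ ω ∂P, ∀ j, 0 ≤ w ω j) (hw1 : ∀ᵐ ω ∂P, ∑ j, w ω j = 1) :
    P.map (fun ω => ∑ i, ∑ j, w ω i * w ω j * S i j / (X ω i * X ω j)) = stdLevy := by
  have hQm : Measurable (fun ω => ∑ i, ∑ j, w ω i * w ω j * S i j / (X ω i * X ω j)) := by
    fun_prop
  have h1 := Measure.isProbabilityMeasure_map (μ := P) hQm.aemeasurable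
  have h2 : IsProbabilityMeasure stdLevy :=
    Measure.isProbabilityMeasure_map (by fun_prop)
  apply laplace_unique
  · rw [ae_map_iff hQm.aemeasurable measurableSet_Ici]
    exact Filter.Eventually.of_forall fun ω => Q_nonneg hS _ _
  · rw [stdLevy, ae_map_iff (by fun_prop) measurableSet_Ici]
    exact Filter.Eventually.of_forall fun z => by positivity
  · intro n
    rw [laplace_random hS hdiag P X hX hXlaw w hw hwX hw0 hw1 n (Nat.cast_nonneg n),
      laplace_levy n (Nat.cast_nonneg n)]
end

section
/- Let Θ be a random variable uniformly distributed on (−π, π], let u_1, …, u_m be arbitrary real constants, and let w = (w_1,…,w_m) be a random vector independent of Θ with w_j ≥ 0 for all j and w_1 + ⋯ + w_m = 1 almost surely. Then Σ_{j=1}^m w_j tan(Θ + u_j) has the standard Cauchy distribution Cauchy(0,1). -/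
open MeasureTheory ProbabilityTheory Real

/-- The standard Cauchy distribution `Cauchy(0,1)`, with density `π⁻¹ (1 + z²)⁻¹` on `ℝ`. -/
noncomputable def stdCauchy : Measure ℝ :=
  volume.withDensity fun z => ENNReal.ofReal (π⁻¹ * (1 + z ^ 2)⁻¹)

/-- The uniform distribution on the interval `(-π, π]`. -/
noncomputable def unifNegPiPi : Measure ℝ :=
  (volume (Set.Ioc (-π) π))⁻¹ • volume.restrict (Set.Ioc (-π) π)

open Filter Topology

/-- Cayley transform of the disc to the upper half plane. -/
noncomputable def cayK (a : ℂ) : ℂ := Complex.I * (1 - a) / (1 + a)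

lemma one_add_ne_of_norm {a : ℂ} (ha : ‖a‖ < 1) : 1 + a ≠ 0 := by
  intro h
  have : a = -1 := by linear_combination h
  rw [this] at ha
  simp at ha

lemma cayK_im {a : ℂ} (ha : ‖a‖ < 1) : 0 ≤ (cayK a).im := by
  have h1 : Complex.normSq a ≤ 1 := by
    rw [Complex.normSq_eq_norm_sq]
    nlinarith [norm_nonneg a]
  have h2 : (cayK a).im = (1 - Complex.normSq a) / Complex.normSq (1 + a) := by
    unfold cayK
    rw [Complex.div_im]
    simp [Complex.normSq_apply]
    ring
  rw [h2]
  exact div_nonneg (by linarith) (Complex.normSq_nonneg _)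

lemma exp_two_I (x : ℝ) :
    Complex.exp (2 * x * Complex.I) = (Complex.cos x + Complex.sin x * Complex.I) ^ 2 := by
  rw [← Complex.exp_mul_I, ← Complex.exp_nat_mul]
  congr 1
  push_cast
  ring

lemma one_add_exp (x : ℝ) : 1 + Complex.exp (2 * x * Complex.I)
    = 2 * Complex.cos x * Complex.exp (x * Complex.I) := by
  rw [exp_two_I, Complex.exp_mul_I]
  linear_combination (Complex.sin x) ^ 2 * Complex.I_sq - Complex.sin_sq_add_cos_sq (x : ℂ)

lemma one_sub_exp (x : ℝ) : 1 - Complex.exp (2 * x * Complex.I)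
    = -2 * Complex.I * Complex.sin x * Complex.exp (x * Complex.I) := by
  rw [exp_two_I, Complex.exp_mul_I]
  linear_combination (Complex.sin x) ^ 2 * Complex.I_sq - Complex.sin_sq_add_cos_sq (x : ℂ)

lemma cayK_exp (x : ℝ) : cayK (Complex.exp (2 * x * Complex.I)) = (Real.tan x : ℂ) := by
  unfold cayK
  rw [one_add_exp, one_sub_exp, Complex.ofReal_tan, Complex.tan_eq_sin_div_cos]
  by_cases h : Complex.cos (x : ℂ) = 0
  · simp [h]
  · have := Complex.exp_ne_zero (x * Complex.I)
    field_simp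
    simp

lemma circ_sq (θ v : ℝ) : circleMap 0 1 θ ^ 2 * Complex.exp (2 * v * Complex.I)
    = Complex.exp (2 * ((θ + v : ℝ) : ℂ) * Complex.I) := by
  simp only [circleMap, zero_add, Complex.ofReal_one, one_mul]
  rw [← Complex.exp_nat_mul, ← Complex.exp_add]
  congr 1
  push_cast
  ring

lemma norm_sq_mul_exp (z : ℂ) (v : ℝ) :
    ‖z ^ 2 * Complex.exp (2 * v * Complex.I)‖ = ‖z‖ ^ 2 := by
  have : ‖Complex.exp (2 * v * Complex.I)‖ = 1 := by
    have := Complex.norm_exp_ofReal_mul_I (2 * v)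
    push_cast at this
    exact this
  rw [norm_mul, this, norm_pow, mul_one]

/-- The analytic extension of the characteristic function integrand. -/
noncomputable def extG {m : ℕ} (w u : Fin m → ℝ) (t : ℝ) (z : ℂ) : ℂ :=
  Complex.exp (t * (∑ j, (w j : ℂ) * cayK (z ^ 2 * Complex.exp (2 * u j * Complex.I))) * Complex.I)

lemma extG_circle {m : ℕ} (w u : Fin m → ℝ) (t θ : ℝ) :
    extG w u t (circleMap 0 1 θ)
      = Complex.exp (t * ((∑ j, w j * Real.tan (θ + u j) : ℝ) : ℂ) * Complex.I) := by
  unfold extG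
  simp only [circ_sq, cayK_exp]
  push_cast
  rfl

lemma extG_diff {m : ℕ} (w u : Fin m → ℝ) (t : ℝ) (z : ℂ)
    (hz : ∀ j, 1 + z ^ 2 * Complex.exp (2 * u j * Complex.I) ≠ 0) :
    DifferentiableAt ℂ (extG w u t) z := by
  unfold extG cayK
  have : DifferentiableAt ℂ (fun z : ℂ => ∑ j, (w j : ℂ) *
      (Complex.I * (1 - z ^ 2 * Complex.exp (2 * u j * Complex.I)) /
        (1 + z ^ 2 * Complex.exp (2 * u j * Complex.I)))) z := by
    apply DifferentiableAt.fun_sum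
    intro j _
    exact ((by fun_prop : DifferentiableAt ℂ (fun z : ℂ => Complex.I * (1 - z ^ 2 * Complex.exp (2 * u j * Complex.I))) z).div (by fun_prop) (hz j)).const_mul _
  exact ((this.const_mul _).mul_const _).cexp

lemma extG_ball {m : ℕ} (w u : Fin m → ℝ) (t : ℝ) (z : ℂ) (hz : ‖z‖ < 1) :
    DifferentiableAt ℂ (extG w u t) z := by
  apply extG_diff
  intro j
  apply one_add_ne_of_norm
  rw [norm_sq_mul_exp]
  nlinarith [norm_nonneg z]

lemma extG_norm {m : ℕ} (w u : Fin m → ℝ) (hw : ∀ j, 0 ≤ w j) (t : ℝ) (ht : 0 ≤ t) (z : ℂ)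
    (hz : ‖z‖ < 1) : ‖extG w u t z‖ ≤ 1 := by
  unfold extG
  rw [Complex.norm_exp]
  apply Real.exp_le_one_iff.2
  have : 0 ≤ (∑ j, (w j : ℂ) * cayK (z ^ 2 * Complex.exp (2 * u j * Complex.I))).im := by
    rw [Complex.im_sum]
    apply Finset.sum_nonneg
    intro j _
    rw [Complex.im_ofReal_mul]
    apply mul_nonneg (hw j)
    apply cayK_im
    rw [norm_sq_mul_exp]
    nlinarith [norm_nonneg z]
  rw [Complex.mul_I_re, Complex.im_ofReal_mul]
  nlinarith [mul_nonneg ht this]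

lemma extG_zero {m : ℕ} (w u : Fin m → ℝ) (hw : ∑ j, w j = 1) (t : ℝ) :
    extG w u t 0 = Real.exp (-t) := by
  unfold extG
  have : (∑ j, (w j : ℂ)) = 1 := by exact_mod_cast hw
  simp only [cayK, ne_eq, OfNat.ofNat_ne_zero, not_false_eq_true, zero_pow, zero_mul, sub_zero,
    mul_one, add_zero, div_one, ← Finset.sum_mul, this, one_mul]
  push_cast
  congr 1
  linear_combination (t : ℂ) * Complex.I_sq

lemma ae_cos {m : ℕ} (u : Fin m → ℝ) : ∀ᵐ θ : ℝ, ∀ j, Real.cos (θ + u j) ≠ 0 := by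
  rw [ae_all_iff]
  intro j
  have : {θ : ℝ | Real.cos (θ + u j) = 0}.Countable := by
    apply (Set.countable_range (fun k : ℤ => (2 * (k : ℝ) + 1) * π / 2 - u j)).mono
    intro θ hθ
    obtain ⟨k, hk⟩ := Real.cos_eq_zero_iff.1 hθ
    exact ⟨k, by simp only; linarith⟩
  have h := this.ae_notMem (volume : Measure ℝ)
  filter_upwards [h] with θ hθ using hθ

lemma main_pos {m : ℕ} (w u : Fin m → ℝ) (hw : ∀ j, 0 ≤ w j) (hw1 : ∑ j, w j = 1)
    (t : ℝ) (ht : 0 ≤ t) :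
    ∫ θ in (0 : ℝ)..2 * π, Complex.exp (t * ((∑ j, w j * Real.tan (θ + u j) : ℝ) : ℂ) * Complex.I)
      = 2 * π * Real.exp (-t) := by
  have hr : ∀ᶠ r : ℝ in 𝓝[<] (1 : ℝ), 0 < r ∧ r < 1 := by
    filter_upwards [Ioo_mem_nhdsLT (zero_lt_one : (0 : ℝ) < 1)] with r hr using hr
  have hn : ∀ r : ℝ, 0 < r ∧ r < 1 → ∀ θ, ‖circleMap 0 r θ‖ < 1 := by
    intro r hr θ
    rw [norm_circleMap_zero, abs_of_pos hr.1]
    exact hr.2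
  have hlim : Tendsto (fun r : ℝ => ∫ θ in (0 : ℝ)..2 * π, extG w u t (circleMap 0 r θ)) (𝓝[<] 1)
      (𝓝 (∫ θ in (0 : ℝ)..2 * π, extG w u t (circleMap 0 1 θ))) := by
    apply intervalIntegral.tendsto_integral_filter_of_dominated_convergence (fun _ => 1)
    · filter_upwards [hr] with r hr
      apply Continuous.aestronglyMeasurable
      rw [continuous_iff_continuousAt]
      intro θ
      exact ContinuousAt.comp (g := extG w u t) (extG_ball w u t _ (hn r hr θ)).continuousAt
        (continuous_circleMap 0 r).continuousAt
    · filter_upwards [hr] with r hr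
      exact ae_of_all _ fun θ _ => extG_norm w u hw t ht _ (hn r hr θ)
    · simp
    · filter_upwards [ae_cos u] with θ hθ _
      have hc : ContinuousAt (extG w u t) (circleMap 0 1 θ) := by
        apply (extG_diff w u t _ _).continuousAt
        intro j
        rw [circ_sq, one_add_exp]
        have := hθ j
        refine mul_ne_zero (mul_ne_zero two_ne_zero ?_) (Complex.exp_ne_zero _)
        rw [← Complex.ofReal_cos]
        exact_mod_cast this
      have h2 : Continuous (fun r : ℝ => circleMap 0 r θ) := by
        unfold circleMap
        fun_prop
      exact hc.tendsto.comp ((h2.tendsto 1).mono_left nhdsWithin_le_nhds)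
  have hconst : ∀ᶠ r : ℝ in 𝓝[<] (1 : ℝ),
      (2 * π * Real.exp (-t) : ℂ) = ∫ θ in (0 : ℝ)..2 * π, extG w u t (circleMap 0 r θ) := by
    filter_upwards [hr] with r hr
    have hd : ∀ z ∈ Metric.closedBall (0 : ℂ) |r|, DifferentiableAt ℂ (extG w u t) z := by
      intro z hz
      apply extG_ball
      rw [abs_of_pos hr.1] at hz
      have := mem_closedBall_zero_iff.1 hz
      linarith
    have h := circleAverage_of_differentiable_on_off_countable (f := extG w u t) (c := 0) (R := r)
      (s := ∅) Set.countable_empty (fun z hz => (hd z hz).continuousAt.continuousWithinAt)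
      (fun z hz => hd z (Metric.ball_subset_closedBall hz.1))
    rw [extG_zero w u hw1, Real.circleAverage_def] at h
    rw [← h, Complex.real_smul]
    have hpi : (π : ℂ) ≠ 0 := by exact_mod_cast Real.pi_ne_zero
    push_cast
    field_simp
  have := tendsto_nhds_unique (tendsto_const_nhds.congr' hconst) hlim
  simp only [extG_circle] at this
  exact this.symm

lemma tan_meas : Measurable Real.tan := by
  have : Real.tan = fun x => Real.sin x / Real.cos x := by
    ext x
    exact Real.tan_eq_sin_div_cos x
  rw [this]
  fun_prop

lemma main_unif {m : ℕ} (w u : Fin m → ℝ) (hw : ∀ j, 0 ≤ w j) (hw1 : ∑ j, w j = 1)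
    (t : ℝ) (ht : 0 ≤ t) :
    ∫ θ, Complex.exp (t * ((∑ j, w j * Real.tan (θ + u j) : ℝ) : ℂ) * Complex.I) ∂unifNegPiPi
      = Real.exp (-t) := by
  have hper : Function.Periodic (fun θ : ℝ =>
      Complex.exp (t * ((∑ j, w j * Real.tan (θ + u j) : ℝ) : ℂ) * Complex.I)) (2 * π) := by
    intro θ
    have : ∀ j, Real.tan (θ + 2 * π + u j) = Real.tan (θ + u j) := by
      intro j
      rw [show θ + 2 * π + u j = θ + u j + π + π by ring, Real.tan_add_pi, Real.tan_add_pi]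
    simp only [this]
  have h := hper.intervalIntegral_add_eq (-π) 0
  rw [zero_add, main_pos w u hw hw1 t ht, show -π + 2 * π = π by ring,
    intervalIntegral.integral_of_le (by linarith [Real.pi_pos])] at h
  rw [unifNegPiPi, integral_smul_measure, h, Real.volume_Ioc, ENNReal.toReal_inv,
    ENNReal.toReal_ofReal (by linarith [Real.pi_pos]), Complex.real_smul]
  have hpi : (π : ℂ) ≠ 0 := by exact_mod_cast Real.pi_ne_zero
  push_cast
  field_simp
  ring

lemma stdCauchy_eq : stdCauchy = cauchyMeasure 0 1 := by
  rw [cauchyMeasure_of_scale_ne_zero _ one_ne_zero, stdCauchy]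
  congr 1
  ext z
  simp [cauchyPDF_def, cauchyPDFReal_def, add_comm]

lemma charFun_cauchy (t : ℝ) (ht : 0 ≤ t) : charFun stdCauchy t = Real.exp (-t) := by
  rw [charFun_apply_real, stdCauchy,
    integral_withDensity_eq_integral_toReal_smul (by fun_prop) (by simp)]
  have h := integral_image_eq_integral_abs_deriv_smul (s := Set.Ioo (-(π / 2)) (π / 2))
    (f := Real.tan) (f' := fun x => 1 / Real.cos x ^ 2) measurableSet_Ioo
    (fun x hx => (Real.hasDerivAt_tan (Real.cos_pos_of_mem_Ioo hx).ne').hasDerivWithinAt)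
    Real.injOn_tan
    (fun x : ℝ => (ENNReal.ofReal (π⁻¹ * (1 + x ^ 2)⁻¹)).toReal • Complex.exp (t * x * Complex.I))
  rw [Real.image_tan_Ioo, Measure.restrict_univ] at h
  rw [h]
  have h2 : ∫ x in Set.Ioo (-(π / 2)) (π / 2), |1 / Real.cos x ^ 2| •
        (ENNReal.ofReal (π⁻¹ * (1 + Real.tan x ^ 2)⁻¹)).toReal •
          Complex.exp (t * (Real.tan x : ℝ) * Complex.I)
      = ∫ x in Set.Ioo (-(π / 2)) (π / 2), (π⁻¹ : ℝ) •
          Complex.exp (t * (Real.tan x : ℝ) * Complex.I) := by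
    apply setIntegral_congr_fun measurableSet_Ioo
    intro x hx
    have hc := Real.cos_pos_of_mem_Ioo hx
    simp only
    rw [smul_smul, ENNReal.toReal_ofReal (by positivity), Real.inv_one_add_tan_sq hc.ne',
      abs_of_pos (by positivity)]
    congr 1
    field_simp
  rw [h2, integral_smul, ← integral_Ioc_eq_integral_Ioo,
    ← intervalIntegral.integral_of_le (by linarith [Real.pi_pos])]
  have hper : Function.Periodic (fun x : ℝ => Complex.exp (t * (Real.tan x : ℝ) * Complex.I)) π := by
    intro x
    simp only [Real.tan_add_pi]
  have e1 := hper.intervalIntegral_add_eq (-(π / 2)) 0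
  have hint : ∀ t₁ t₂ : ℝ, IntervalIntegrable
      (fun x : ℝ => Complex.exp (t * (Real.tan x : ℝ) * Complex.I)) volume t₁ t₂ := by
    intro t₁ t₂
    have hm : Measurable (fun x : ℝ => Complex.exp (t * (Real.tan x : ℝ) * Complex.I)) := by
      have := tan_meas
      fun_prop
    apply (intervalIntegrable_const (c := (1 : ℝ))).mono_fun hm.aestronglyMeasurable
    refine ae_of_all _ fun x => ?_
    beta_reduce
    rw [← Complex.ofReal_mul, Complex.norm_exp_ofReal_mul_I]
    simp
  have e2 := hper.intervalIntegral_add_zsmul_eq 2 0 hint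
  have e3 := main_pos (m := 1) (fun _ => 1) (fun _ => 0) (by simp) (by simp) t ht
  simp only [Finset.univ_unique, Finset.sum_const, Finset.card_singleton, one_smul, one_mul,
    add_zero] at e3
  rw [show -(π / 2) + π = π / 2 by ring, zero_add] at e1
  simp only [zero_add, zsmul_eq_mul, Int.cast_ofNat] at e2
  rw [e3] at e2
  rw [e1, Complex.real_smul]
  have hpi : (π : ℂ) ≠ 0 := by exact_mod_cast Real.pi_ne_zero
  push_cast at e2 ⊢
  field_simp
  linear_combination -e2 / 2

lemma ext_charFun_nonneg (μ ν : Measure ℝ) [IsFiniteMeasure μ] [IsFiniteMeasure ν]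
    (h : ∀ t : ℝ, 0 ≤ t → charFun μ t = charFun ν t) : μ = ν := by
  apply Measure.ext_of_charFun
  ext t
  rcases le_total 0 t with ht | ht
  · exact h t ht
  · have := h (-t) (by linarith)
    rw [charFun_neg, charFun_neg] at this
    exact (starRingEnd ℂ).injective this

theorem statement6 {m : ℕ}
    {Ω : Type*} [MeasurableSpace Ω] (P : Measure Ω) [IsProbabilityMeasure P]
    (Θ : Ω → ℝ) (hΘ : Measurable Θ) (hΘlaw : P.map Θ = unifNegPiPi)
    (u : Fin m → ℝ)
    (w : Ω → Fin m → ℝ) (hw : Measurable w) (hwΘ : IndepFun w Θ P)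
    (hw0 : ∀ᵐ ω ∂P, ∀ j, 0 ≤ w ω j) (hw1 : ∀ᵐ ω ∂P, ∑ j, w ω j = 1) :
    P.map (fun ω => ∑ j, w ω j * Real.tan (Θ ω + u j)) = stdCauchy := by
  have hF : Measurable (fun p : (Fin m → ℝ) × ℝ => ∑ j, p.1 j * Real.tan (p.2 + u j)) := by
    apply Finset.measurable_fun_sum
    intro j _
    exact ((measurable_pi_apply j).comp measurable_fst).mul
      (tan_meas.comp (measurable_snd.add_const _))
  have hX : Measurable (fun ω => ∑ j, w ω j * Real.tan (Θ ω + u j)) := hF.comp (hw.prodMk hΘ)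
  have : IsFiniteMeasure stdCauchy := by
    rw [stdCauchy_eq]
    infer_instance
  have : IsProbabilityMeasure (P.map Θ) := Measure.isProbabilityMeasure_map hΘ.aemeasurable
  have : IsProbabilityMeasure (P.map w) := Measure.isProbabilityMeasure_map hw.aemeasurable
  apply ext_charFun_nonneg
  intro t ht
  rw [charFun_cauchy t ht, charFun_apply_real,
    integral_map hX.aemeasurable (by fun_prop)]
  have hG : Measurable (fun p : (Fin m → ℝ) × ℝ => Complex.exp
      (t * ((∑ j, p.1 j * Real.tan (p.2 + u j) : ℝ) : ℂ) * Complex.I)) := by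
    fun_prop
  have h1 := integral_map (μ := P) (hw.prodMk hΘ).aemeasurable hG.aestronglyMeasurable
  rw [← h1, (indepFun_iff_map_prod_eq_prod_map_map hw.aemeasurable hΘ.aemeasurable).1 hwΘ,
    integral_prod]
  · have h2 : ∀ᵐ v ∂(P.map w), ∫ θ, Complex.exp
        (t * ((∑ j, v j * Real.tan (θ + u j) : ℝ) : ℂ) * Complex.I) ∂(P.map Θ)
        = Real.exp (-t) := by
      have hs : MeasurableSet {v : Fin m → ℝ | (∀ j, 0 ≤ v j) ∧ ∑ j, v j = 1} := by
        measurability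
      have h3 : ∀ᵐ v ∂(P.map w), (∀ j, 0 ≤ v j) ∧ ∑ j, v j = 1 := by
        rw [ae_map_iff hw.aemeasurable hs]
        filter_upwards [hw0, hw1] with ω a b using ⟨a, b⟩
      filter_upwards [h3] with v hv
      rw [hΘlaw]
      exact main_unif v u hv.1 hv.2 t ht
    rw [integral_congr_ae h2]
    simp
  · apply Integrable.of_bound hG.aestronglyMeasurable 1
    refine ae_of_all _ fun p => ?_
    rw [← Complex.ofReal_mul, Complex.norm_exp_ofReal_mul_I]
end
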